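/- arXiv:1408.0525 — 2 statements merged into one kernel-verified Lean document; each statement's English description precedes it below -/
import Mathlib

section
/- Let A, B be positive real operators on a Hilbert space H with A ≺ B, and let C be a bounded operator from another Hilbert space H' to H. Then C*AC ≺ C*BC, i.e. C*AC - C*BC = Re(C*BC)^{1/2} Z Re(C*BC)^{1/2} for some bounded Z. -/
open ContinuousLinearMap

variable {H : Type*} [NormedAddCommGroup H] [InnerProductSpace ℂ H] [CompleteSpace H]

/-- The real part `(T + T*)/2` of a bounded operator. -/
noncomputable def opRe (T : H →L[ℂ] H) : H →L[ℂ] H :=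
  (2 : ℂ)⁻¹ • (T + ContinuousLinearMap.adjoint T)

/-- The positive square root of the real part of an operator. -/
noncomputable def sqrtRe (T : H →L[ℂ] H) : H →L[ℂ] H := CFC.sqrt (opRe T)

/-- The pre-order `A ≺ B` on positive real operators. -/
noncomputable def prec (A B : H →L[ℂ] H) : Prop :=
  ∃ X : H →L[ℂ] H, A - B = sqrtRe B ∘L X ∘L sqrtRe B

/-- Douglas factorization, from a pointwise norm bound. -/
theorem douglas_aux {K L : Type*} [NormedAddCommGroup K] [InnerProductSpace ℂ K] [CompleteSpace K]
    [NormedAddCommGroup L] [InnerProductSpace ℂ L] [CompleteSpace L]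
    (T : K →L[ℂ] K) (G : K →L[ℂ] L) (hn : ∀ x, ‖G x‖ = ‖T x‖) :
    ∃ W : K →L[ℂ] L, G = W ∘L T := by
  let M : Submodule ℂ K := (LinearMap.range (T : K →ₗ[ℂ] K)).topologicalClosure
  have hM : ∀ x, T x ∈ M := fun x =>
    Submodule.le_topologicalClosure _ (LinearMap.mem_range_self (T : K →ₗ[ℂ] K) x)
  have : CompleteSpace M :=
    (Submodule.isClosed_topologicalClosure (LinearMap.range (T : K →ₗ[ℂ] K))).completeSpace_coe
  let e : K →ₗ[ℂ] M := LinearMap.codRestrict M (T : K →ₗ[ℂ] K) hM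
  have hd : DenseRange e := by
    intro y
    rw [closure_subtype]
    have h1 : (Subtype.val '' Set.range e : Set K) = Set.range T := by
      ext z
      constructor
      · rintro ⟨_, ⟨x, rfl⟩, rfl⟩
        exact ⟨x, rfl⟩
      · rintro ⟨x, rfl⟩
        exact ⟨e x, ⟨x, rfl⟩, rfl⟩
    rw [h1]
    have h2 := y.2
    rw [← SetLike.mem_coe, Submodule.topologicalClosure_coe] at h2
    exact h2
  have hb : ∃ c : ℝ, ∀ x, ‖(G : K →ₗ[ℂ] L) x‖ ≤ c * ‖e x‖ :=
    ⟨1, fun x => by rw [one_mul]; exact (hn x).le⟩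
  refine ⟨((G : K →ₗ[ℂ] L).extendOfNorm e) ∘L M.orthogonalProjectionOnto, ?_⟩
  ext x
  have h3 : M.orthogonalProjectionOnto (T x) = e x :=
    Submodule.orthogonalProjectionOnto_mem_subspace_eq_self (K := M) (e x)
  rw [ContinuousLinearMap.comp_apply, ContinuousLinearMap.comp_apply, h3, LinearMap.extendOfNorm_eq hd hb]
  rfl

theorem stmt9 {H' : Type*} [NormedAddCommGroup H'] [InnerProductSpace ℂ H']
    [CompleteSpace H'] (A B : H →L[ℂ] H) (C : H' →L[ℂ] H)
    (hA : (opRe A).IsPositive) (hB : (opRe B).IsPositive)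
    (h : prec A B) :
    prec (ContinuousLinearMap.adjoint C ∘L A ∘L C)
      (ContinuousLinearMap.adjoint C ∘L B ∘L C) := by
  obtain ⟨X, hX⟩ := h
  have hre : opRe (adjoint C ∘L B ∘L C) = adjoint C ∘L opRe B ∘L C := by
    unfold opRe
    simp only [adjoint_comp, adjoint_adjoint]
    ext x
    simp
  have hpos : (opRe (adjoint C ∘L B ∘L C)).IsPositive := by
    rw [hre]
    exact hB.adjoint_conj C
  have hS : adjoint (sqrtRe B) = sqrtRe B :=
    ((nonneg_iff_isPositive _).1 (CFC.sqrt_nonneg (opRe B))).isSelfAdjoint.adjoint_eq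
  have hSS : sqrtRe B ∘L sqrtRe B = opRe B :=
    CFC.sqrt_mul_sqrt_self _ ((nonneg_iff_isPositive _).2 hB)
  have key' : adjoint (sqrtRe (adjoint C ∘L B ∘L C)) = sqrtRe (adjoint C ∘L B ∘L C) ∧
      sqrtRe (adjoint C ∘L B ∘L C) ∘L sqrtRe (adjoint C ∘L B ∘L C)
        = opRe (adjoint C ∘L B ∘L C) :=
    ⟨((nonneg_iff_isPositive _).1 (CFC.sqrt_nonneg
        (opRe (adjoint C ∘L B ∘L C)))).isSelfAdjoint.adjoint_eq,
      CFC.sqrt_mul_sqrt_self _ ((nonneg_iff_isPositive _).2 hpos)⟩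
  obtain ⟨hT, hTT⟩ := key'
  unfold prec
  set S := sqrtRe B with hSdef
  set T := sqrtRe (adjoint C ∘L B ∘L C) with hTdef
  have hn : ∀ x, ‖(S ∘L C) x‖ = ‖T x‖ := by
    intro x
    have e1 : adjoint (S ∘L C) ∘L (S ∘L C) = adjoint T ∘L T := by
      rw [hT, hTT, hre, ← hSS, adjoint_comp, hS]
      rfl
    have e2 := apply_norm_sq_eq_inner_adjoint_left (S ∘L C) x
    have e3 := apply_norm_sq_eq_inner_adjoint_left T x
    rw [e1, ← e3] at e2
    exact (sq_eq_sq₀ (norm_nonneg _) (norm_nonneg _)).1 e2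
  obtain ⟨W, hW⟩ := douglas_aux T (S ∘L C) hn
  refine ⟨adjoint W ∘L X ∘L W, ?_⟩
  have hW2 : adjoint C ∘L S = T ∘L adjoint W := by
    have := congrArg adjoint hW
    rwa [adjoint_comp, adjoint_comp, hS, hT] at this
  calc adjoint C ∘L A ∘L C - adjoint C ∘L B ∘L C = adjoint C ∘L (A - B) ∘L C := by
        ext x; simp
    _ = (adjoint C ∘L S) ∘L X ∘L (S ∘L C) := by rw [hX]; rfl
    _ = _ := by rw [hW2, hW]; rfl
end

section
/- Let F : 𝔻 → L(U) be a holomorphic function on the open unit disc with values in operators on a finite-dimensional Hilbert space U, with Re(F(λ)) ≥ 0 for all λ. Let G be another such (Carathéodory class) function with F − G = Re(G)^{1/2} Q Re(G)^{1/2} pointwise, where Q is bounded on 𝔻 with sup norm ‖Q‖_∞. If λ_t, t ∈ (0,1], is a continuous curve in the closed disc with λ_t ∈ 𝔻 for t < 1, G(λ₁) exists with Re(G(λ₁)) ≥ 0, and for some u ∈ U, G(λ_t)u → 0 as t → 1, then F(λ_t)u → 0 as t → 1. -/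
open ContinuousLinearMap

variable {H : Type*} [NormedAddCommGroup H] [InnerProductSpace ℂ H] [CompleteSpace H]

theorem sqrtRe_sq_le {H : Type*} [NormedAddCommGroup H] [InnerProductSpace ℂ H]
    [CompleteSpace H] (T : H →L[ℂ] H) (hT : (opRe T).IsPositive) (v : H) :
    ‖sqrtRe T v‖ ^ 2 ≤ ‖v‖ * ‖T v‖ := by
  have h0 : (0 : H →L[ℂ] H) ≤ opRe T := (ContinuousLinearMap.nonneg_iff_isPositive _).2 hT
  have hS : (0 : H →L[ℂ] H) ≤ sqrtRe T := CFC.sqrt_nonneg (opRe T)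
  have hsym := ((ContinuousLinearMap.nonneg_iff_isPositive _).1 hS).isSymmetric
  have hmul : sqrtRe T * sqrtRe T = opRe T := CFC.sqrt_mul_sqrt_self (opRe T) h0
  have h1 : inner ℂ (sqrtRe T v) (sqrtRe T v) = inner ℂ v (opRe T v) := by
    rw [← hmul]
    exact hsym v (sqrtRe T v)
  have h2 : inner ℂ v (opRe T v) = (2 : ℂ)⁻¹ * (inner ℂ v (T v) + inner ℂ (T v) v) := by
    simp [opRe, ContinuousLinearMap.adjoint_inner_right]
    ring
  have h3 : ((‖sqrtRe T v‖ ^ 2 : ℝ) : ℂ) =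
      (2 : ℂ)⁻¹ * (inner ℂ v (T v) + inner ℂ (T v) v) := by
    rw [← h2, ← h1, inner_self_eq_norm_sq_to_K]
    simp
  have h4 : ‖((‖sqrtRe T v‖ ^ 2 : ℝ) : ℂ)‖ = ‖sqrtRe T v‖ ^ 2 := by
    rw [Complex.norm_real, Real.norm_of_nonneg (by positivity)]
  rw [← h4, h3, norm_mul]
  have h5 := norm_add_le (inner ℂ v (T v)) (inner ℂ (T v) v)
  have h6 := norm_inner_le_norm (𝕜 := ℂ) v (T v)
  have h7 := norm_inner_le_norm (𝕜 := ℂ) (T v) v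
  have h8 : ‖(2 : ℂ)⁻¹‖ = 1 / 2 := by norm_num
  rw [h8]
  linarith

theorem sqrtRe_le {H : Type*} [NormedAddCommGroup H] [InnerProductSpace ℂ H]
    [CompleteSpace H] (T : H →L[ℂ] H) (hT : (opRe T).IsPositive) (v : H) :
    ‖sqrtRe T v‖ ≤ √(‖v‖ * ‖T v‖) :=
  Real.le_sqrt_of_sq_le (sqrtRe_sq_le T hT v)

theorem norm_sqrtRe_le {H : Type*} [NormedAddCommGroup H] [InnerProductSpace ℂ H]
    [CompleteSpace H] (T : H →L[ℂ] H) (hT : (opRe T).IsPositive) :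
    ‖sqrtRe T‖ ≤ √‖T‖ := by
  refine ContinuousLinearMap.opNorm_le_bound _ (Real.sqrt_nonneg _) fun v => ?_
  refine (sqrtRe_le T hT v).trans ?_
  refine Real.sqrt_le_iff.2 ⟨by positivity, ?_⟩
  rw [mul_pow, Real.sq_sqrt (norm_nonneg _)]
  nlinarith [T.le_opNorm v, norm_nonneg v]

open Metric Filter in
theorem stmt18 {U : Type*} [NormedAddCommGroup U] [InnerProductSpace ℂ U]
    [FiniteDimensional ℂ U]
    (F G Q : ℂ → (U →L[ℂ] U)) (c : ℝ) (γ : ℝ → ℂ) (u : U) (L : U →L[ℂ] U)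
    (hFhol : DifferentiableOn ℂ F (ball 0 1))
    (hGhol : DifferentiableOn ℂ G (ball 0 1))
    (hFpr : ∀ z ∈ ball (0 : ℂ) 1, (opRe (F z)).IsPositive)
    (hGpr : ∀ z ∈ ball (0 : ℂ) 1, (opRe (G z)).IsPositive)
    (hQ : ∀ z ∈ ball (0 : ℂ) 1, F z - G z = sqrtRe (G z) ∘L Q z ∘L sqrtRe (G z))
    (hQb : ∀ z ∈ ball (0 : ℂ) 1, ‖Q z‖ ≤ c)
    (hγcont : ContinuousOn γ (Set.Ioc 0 1))
    (hγcl : ∀ t ∈ Set.Ioc (0 : ℝ) 1, γ t ∈ closedBall (0 : ℂ) 1)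
    (hγin : ∀ t ∈ Set.Ioo (0 : ℝ) 1, γ t ∈ ball (0 : ℂ) 1)
    -- `G(λ₁)` exists (as the limit of `G` along the curve) and is positive real:
    (hGlim : Tendsto (fun t => G (γ t)) (nhdsWithin 1 (Set.Ioo 0 1)) (nhds L))
    (hL : (opRe L).IsPositive)
    (hGu : Tendsto (fun t => G (γ t) u) (nhdsWithin 1 (Set.Ioo 0 1)) (nhds 0)) :
    Tendsto (fun t => F (γ t) u) (nhdsWithin 1 (Set.Ioo 0 1)) (nhds 0) := by
  have hb : ∀ᶠ t in nhdsWithin (1 : ℝ) (Set.Ioo 0 1), ‖F (γ t) u‖ ≤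
      ‖G (γ t) u‖ + √‖G (γ t)‖ * (c * √(‖u‖ * ‖G (γ t) u‖)) := by
    filter_upwards [self_mem_nhdsWithin] with t ht
    have hz := hγin t ht
    have hc : 0 ≤ c := (norm_nonneg _).trans (hQb _ hz)
    have e : F (γ t) u = G (γ t) u +
        sqrtRe (G (γ t)) (Q (γ t) (sqrtRe (G (γ t)) u)) := by
      have := congrArg (fun A : U →L[ℂ] U => A u) (hQ _ hz)
      simp only [sub_apply, ContinuousLinearMap.comp_apply] at this
      rw [← this]
      abel
    rw [e]
    refine (norm_add_le _ _).trans (add_le_add le_rfl ?_)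
    refine (ContinuousLinearMap.le_opNorm _ _).trans ?_
    refine mul_le_mul (norm_sqrtRe_le _ (hGpr _ hz)) ?_ (norm_nonneg _) (Real.sqrt_nonneg _)
    refine (ContinuousLinearMap.le_opNorm _ _).trans ?_
    exact mul_le_mul (hQb _ hz) (sqrtRe_le _ (hGpr _ hz) u) (norm_nonneg _) hc
  refine squeeze_zero_norm' hb ?_
  have h1 := hGu.norm
  have h2 := hGlim.norm.sqrt
  have h3 := ((h1.const_mul ‖u‖).sqrt).const_mul c
  have h4 := h1.add (h2.mul h3)
  simpa using h4
end
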